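/- The operator R(x;φ) satisfies the shifted braid-type Yang–Baxter equation with shift vectors Ψ: for all x, y ∈ ℂ and φ ∈ ℂ³ that are admissible for this identity, R₁₂(x; φ+Ψ̂(−κ)₃) ∘ R₂₃(x+y; φ+Ψ̂(κ)₁) ∘ R₁₂(y; φ+Ψ̂(−κ)₃) = R₂₃(y; φ+Ψ̂(κ)₁) ∘ R₁₂(x+y; φ+Ψ̂(−κ)₃) ∘ R₂₃(x; φ+Ψ̂(κ)₁) as linear operators on V ⊗ V ⊗ V. -/

import Mathlib

noncomputable section

open Complex

/-- `p^w := exp(w · log p)` for a real base `p` and complex exponent `w`. -/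
def pPow (p : ℝ) (w : ℂ) : ℂ := Complex.exp (w * (Real.log p : ℂ))

/-- The renormalised Jacobi theta function
`θ(z;p) = ∏_{m=0}^∞ (1 − p^m z)(1 − p^{m+1}/z)`. -/
def theta (p : ℝ) (z : ℂ) : ℂ :=
  ∏' m : ℕ, ((1 - (p : ℂ) ^ m * z) * (1 - (p : ℂ) ^ (m + 1) / z))

/-- `A^y(x)`. -/
def Afun (p : ℝ) (κ y x : ℂ) : ℂ :=
  (theta p (pPow p (2 * κ)) * theta p (pPow p (y - x)) /
      (theta p (pPow p y) * theta p (pPow p (2 * κ - x)))) *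
    pPow p ((2 * κ - y) * x)

/-- `B^y(x)`. -/
def Bfun (p : ℝ) (κ y x : ℂ) : ℂ :=
  (theta p (pPow p (2 * κ - y)) * theta p (pPow p (-x)) /
      (theta p (pPow p (2 * κ - x)) * theta p (pPow p (-y)))) *
    pPow p (2 * κ * (x - y))

/-- The elliptic `c`-function `c(x) = p^{2κx} θ(p^{2κ+x};p)/θ(p^x;p)`. -/
def cfun (p : ℝ) (κ x : ℂ) : ℂ :=
  pPow p (2 * κ * x) * theta p (pPow p (2 * κ + x)) / theta p (pPow p x)

/-- `(−1)^{p(i)}` for the parity map `p(1)=p(2)=0`, `p(3)=1` (indices `0,1,2` in Lean). -/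
def sgn3 (i : Fin 3) : ℂ := if i = 2 then -1 else 1

/-- The matrix of the elliptic dynamical `R`-operator `R(x;φ)` on `V ⊗ V`, `V = ℂ³`,
with respect to the basis `v_i ⊗ v_j` (the pair `(i,j)` indexes the column, i.e. the input):
`R(x;φ)(v_i ⊗ v_i) = (−1)^{p(i)} (c(x)/c((−1)^{p(i)}x)) v_i ⊗ v_i` and, for `i ≠ j`,
`R(x;φ)(v_i ⊗ v_j) = A^{φ_i−φ_j}(x) v_i ⊗ v_j + (−1)^{p(i)+p(j)} B^{φ_i−φ_j}(x) v_j ⊗ v_i`. -/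
def Rop (p : ℝ) (κ x : ℂ) (φ : Fin 3 → ℂ) :
    Matrix (Fin 3 × Fin 3) (Fin 3 × Fin 3) ℂ := fun ab ij =>
  if ij.1 = ij.2 then
    (if ab = ij then sgn3 ij.1 * (cfun p κ x / cfun p κ (sgn3 ij.1 * x)) else 0)
  else
    (if ab = ij then Afun p κ (φ ij.1 - φ ij.2) x else 0) +
      (if ab = (ij.2, ij.1) then sgn3 ij.1 * sgn3 ij.2 * Bfun p κ (φ ij.1 - φ ij.2) x else 0)

/-- Admissibility of the parameters `(x,φ)` for the operator `R(x;φ)`: every theta-function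
factor occurring in a denominator of an entry of `R(x;φ)` is nonzero. -/
def RAdm (p : ℝ) (κ x : ℂ) (φ : Fin 3 → ℂ) : Prop :=
  theta p (pPow p x) ≠ 0 ∧ theta p (pPow p (2 * κ + x)) ≠ 0 ∧
    theta p (pPow p (2 * κ - x)) ≠ 0 ∧
    ∀ i j : Fin 3, i ≠ j → theta p (pPow p (φ i - φ j)) ≠ 0


/-- The weights of the vector representation `V`:
`wt(1) = (1,0,0)`, `wt(2) = (0,1,0)`, `wt(3) = (0,0,−1)` (indices `0,1,2` in Lean). -/
def wt3 (k : Fin 3) : Fin 3 → ℂ := fun j => if j = k then sgn3 k else 0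

/-- For a family `ψ : Fin 3 → (Fin 3 → ℂ)` of dynamical parameters, the operator on
`V ⊗ V ⊗ V` acting on `v_a ⊗ v_b ⊗ v_c` as `(R(x; ψ c)(v_a ⊗ v_b)) ⊗ v_c`. -/
def R12 (p : ℝ) (κ x : ℂ) (ψ : Fin 3 → Fin 3 → ℂ) :
    Matrix (Fin 3 × Fin 3 × Fin 3) (Fin 3 × Fin 3 × Fin 3) ℂ := fun a b =>
  if a.2.2 = b.2.2 then Rop p κ x (ψ b.2.2) (a.1, a.2.1) (b.1, b.2.1) else 0

/-- For a family `ψ : Fin 3 → (Fin 3 → ℂ)` of dynamical parameters, the operator on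
`V ⊗ V ⊗ V` acting on `v_a ⊗ v_b ⊗ v_c` as `v_a ⊗ (R(x; ψ a)(v_b ⊗ v_c))`. -/
def R23 (p : ℝ) (κ x : ℂ) (ψ : Fin 3 → Fin 3 → ℂ) :
    Matrix (Fin 3 × Fin 3 × Fin 3) (Fin 3 × Fin 3 × Fin 3) ℂ := fun a b =>
  if a.1 = b.1 then Rop p κ x (ψ b.1) (a.2.1, a.2.2) (b.2.1, b.2.2) else 0

/-- The shift vectors `Ψ^{(j)}(α)` : `Ψ^{(1)}(α) = (−α, 0, −π√−1 (log p)⁻¹)`,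
`Ψ^{(2)}(α) = (0, −α, −π√−1 (log p)⁻¹)`, `Ψ^{(3)}(α) = (0, 0, α)`. -/
def Psi (p : ℝ) (α : ℂ) : Fin 3 → Fin 3 → ℂ := fun k =>
  if k = 0 then ![-α, 0, -(Real.pi : ℂ) * Complex.I * (Real.log p : ℂ)⁻¹]
  else if k = 1 then ![0, -α, -(Real.pi : ℂ) * Complex.I * (Real.log p : ℂ)⁻¹]
  else ![0, 0, α]

/-! ### The Jacobi triple product -/

lemma pPow_add (p : ℝ) (a b : ℂ) : pPow p (a + b) = pPow p a * pPow p b := by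
  simp [pPow, add_mul, Complex.exp_add]

lemma pPow_zero (p : ℝ) : pPow p 0 = 1 := by simp [pPow]

lemma pPow_ne_zero (p : ℝ) (a : ℂ) : pPow p a ≠ 0 := Complex.exp_ne_zero _

lemma pPow_neg (p : ℝ) (a : ℂ) : pPow p (-a) = (pPow p a)⁻¹ := by
  simp [pPow, Complex.exp_neg]

lemma pPow_sub (p : ℝ) (a b : ℂ) : pPow p (a - b) = pPow p a / pPow p b := by
  simp [pPow, sub_mul, Complex.exp_sub]

lemma pPow_intCast {p : ℝ} (hp : 0 < p) (n : ℤ) : pPow p n = (p : ℂ) ^ n := by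
  rw [pPow, Complex.exp_int_mul, ← Complex.ofReal_exp, Real.exp_log hp]

/-- A two-sided Gaussian series in the base `p`. -/
lemma summable_pPow_gaussian {p : ℝ} (hp0 : 0 < p) (hp1 : p < 1) {a : ℝ} (ha : 0 < a) (b c : ℂ) :
    Summable fun n : ℤ => pPow p (a * n ^ 2 + b * n + c) := by
  have hL : Real.log p < 0 := Real.log_neg hp0 hp1
  have hpi : (Real.pi : ℂ) ≠ 0 := by exact_mod_cast Real.pi_ne_zero
  have h := (summable_jacobiTheta₂_term_iff (b * Real.log p / (2 * Real.pi * I))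
    (((-(a * Real.log p) / Real.pi : ℝ) : ℂ) * I)).2 (by
      simp only [Complex.mul_im, Complex.I_im, Complex.I_re, Complex.ofReal_re,
        Complex.ofReal_im, mul_one, mul_zero, add_zero]
      exact div_pos (by nlinarith) Real.pi_pos)
  refine (h.mul_right (pPow p c)).congr fun n => ?_
  rw [jacobiTheta₂_term, pPow, pPow, ← Complex.exp_add]
  congr 1
  push_cast
  field_simp
  rw [show (I : ℂ) ^ 2 = -1 from Complex.I_sq]
  ring

/-- The terms `(-1)^n p^{n(n-1)/2} z^n` of the Jacobi triple product, where `z = p^w`. -/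
def tripleTerm (p : ℝ) (w : ℂ) (n : ℤ) : ℂ :=
  (-1) ^ n * pPow p (n * (n - 1) / 2 + n * w)

lemma summable_tripleTerm {p : ℝ} (hp0 : 0 < p) (hp1 : p < 1) (w : ℂ) :
    Summable (tripleTerm p w) := by
  refine Summable.of_norm ?_
  refine (summable_pPow_gaussian hp0 hp1 (a := 1 / 2) (by norm_num) (w - 1 / 2) 0).norm.congr
    fun n => ?_
  rw [tripleTerm, norm_mul, norm_zpow, norm_neg, norm_one, one_zpow, one_mul]
  congr 2
  push_cast
  ring

lemma tripleTerm_mul_pPow {p : ℝ} (hp0 : 0 < p) (w : ℂ) (n : ℤ) :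
    pPow p w * tripleTerm p w (n - 1) = -((p : ℂ) / (p : ℂ) ^ n) * tripleTerm p w n := by
  have hp : (p : ℂ) ≠ 0 := by exact_mod_cast hp0.ne'
  have h1 : pPow p (n * (n - 1) / 2 + n * w) =
      pPow p w * (pPow p ((n - 1 : ℤ) * ((n - 1 : ℤ) - 1) / 2 + (n - 1 : ℤ) * w) *
        pPow p (n - 1 : ℤ)) := by
    rw [← pPow_add, ← pPow_add]; congr 1; push_cast; ring
  rw [tripleTerm, tripleTerm, h1, pPow_intCast hp0, zpow_sub_one₀ (by norm_num), zpow_sub_one₀ hp]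
  have := zpow_ne_zero n hp
  field_simp

lemma tripleTerm_div_pPow {p : ℝ} (hp0 : 0 < p) (w : ℂ) (n : ℤ) :
    tripleTerm p w (n + 1) / pPow p w = -(p : ℂ) ^ n * tripleTerm p w n := by
  have hp : (p : ℂ) ≠ 0 := by exact_mod_cast hp0.ne'
  have h := tripleTerm_mul_pPow hp0 w (n + 1)
  have hz := pPow_ne_zero p w
  have := zpow_ne_zero n hp
  rw [add_sub_cancel_right, zpow_add_one₀ hp] at h
  field_simp at h ⊢
  linear_combination h

/-- The finite Pochhammer symbol `(p;p)_n`. -/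
def poch (p : ℝ) (n : ℕ) : ℂ := ∏ i ∈ Finset.range n, (1 + -(p : ℂ) ^ (i + 1))

/-- The reciprocal Pochhammer symbol `1/(p;p)_k`, extended by zero to negative `k`. -/
def rpoch (p : ℝ) (k : ℤ) : ℂ := if k < 0 then 0 else (poch p k.toNat)⁻¹

lemma one_sub_pow_ne_zero {p : ℝ} (hp0 : 0 < p) (hp1 : p < 1) (i : ℕ) :
    1 + -(p : ℂ) ^ (i + 1) ≠ 0 := by
  have h : p ^ (i + 1) < 1 := pow_lt_one₀ hp0.le hp1 (by simp)
  have h2 : 1 + -p ^ (i + 1) ≠ 0 := by linarith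
  exact_mod_cast h2

lemma summable_norm_pow_succ {p : ℝ} (hp0 : 0 < p) (hp1 : p < 1) :
    Summable fun i : ℕ => ‖-(p : ℂ) ^ (i + 1)‖ := by
  simpa [abs_of_pos hp0] using
    (summable_nat_add_iff 1).2 (summable_geometric_of_lt_one hp0.le hp1)

lemma poch_ne_zero {p : ℝ} (hp0 : 0 < p) (hp1 : p < 1) (n : ℕ) : poch p n ≠ 0 :=
  Finset.prod_ne_zero_iff.2 fun i _ => one_sub_pow_ne_zero hp0 hp1 i

lemma exists_tendsto_poch {p : ℝ} (hp0 : 0 < p) (hp1 : p < 1) :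
    ∃ Q : ℂ, Q ≠ 0 ∧ Filter.Tendsto (poch p) Filter.atTop (nhds Q) :=
  ⟨_, tprod_one_add_ne_zero_of_summable (one_sub_pow_ne_zero hp0 hp1)
      (summable_norm_pow_succ hp0 hp1),
    (multipliable_one_add_of_summable
      (summable_norm_pow_succ hp0 hp1)).hasProd.tendsto_prod_nat⟩

lemma rpoch_sub_one {p : ℝ} (hp0 : 0 < p) (hp1 : p < 1) (k : ℤ) :
    rpoch p (k - 1) = (1 - (p : ℂ) ^ k) * rpoch p k := by
  rcases lt_trichotomy k 0 with hk | rfl | hk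
  · simp [rpoch, hk, show k < 1 by omega]
  · simp [rpoch]
  · obtain ⟨m, rfl⟩ : ∃ m : ℕ, k = m + 1 := ⟨(k - 1).toNat, by omega⟩
    have h1 : ¬ ((m : ℤ) + 1 < 0) := by omega
    have h2 : ((m : ℤ) + 1).toNat = m + 1 := by omega
    have h3 := one_sub_pow_ne_zero hp0 hp1 m
    have h4 := poch_ne_zero hp0 hp1 m
    have h5 : (p : ℂ) ^ ((m : ℤ) + 1) = (p : ℂ) ^ (m + 1) := by exact_mod_cast rfl
    have h6 : poch p (m + 1) = poch p m * (1 + -(p : ℂ) ^ (m + 1)) := Finset.prod_range_succ _ _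
    rw [add_sub_cancel_right, rpoch, rpoch, if_neg h1, if_neg (by omega), h2, h5, h6,
      Int.toNat_natCast, ← sub_eq_add_neg]
    rw [← sub_eq_add_neg] at h3
    field_simp

/-- The finite form of the Jacobi triple product. -/
lemma hasSum_finite_tripleProduct {p : ℝ} (hp0 : 0 < p) (hp1 : p < 1) (w : ℂ) (N : ℕ) :
    HasSum (fun n : ℤ => poch p (2 * N) * rpoch p (N - n) * rpoch p (N + n) * tripleTerm p w n)
      (∏ m ∈ Finset.range N,
        ((1 - (p : ℂ) ^ m * pPow p w) * (1 - (p : ℂ) ^ (m + 1) / pPow p w))) := by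
  have hp : (p : ℂ) ≠ 0 := by exact_mod_cast hp0.ne'
  have hz := pPow_ne_zero p w
  induction N with
  | zero =>
    convert hasSum_single (f := fun n : ℤ => poch p (2 * 0) * rpoch p ((0 : ℕ) - n) *
      rpoch p ((0 : ℕ) + n) * tripleTerm p w n) 0 ?_ using 1
    · simp [poch, rpoch, tripleTerm, pPow_zero]
    · intro n hn
      rcases lt_or_gt_of_ne hn with h | h <;> simp [rpoch, h]
  | succ N ih =>
    rw [Finset.prod_range_succ]
    have hm := (Equiv.addRight (-1 : ℤ)).hasSum_iff.2 ih
    have hq := (Equiv.addRight (1 : ℤ)).hasSum_iff.2 ih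
    have h := ((ih.mul_left (1 + (p : ℂ) ^ (2 * N + 1))).sub
      (hm.mul_left ((p : ℂ) ^ N * pPow p w))).sub (hq.mul_left ((p : ℂ) ^ (N + 1) / pPow p w))
    have hv : ∀ P : ℂ, P * ((1 - (p : ℂ) ^ N * pPow p w) * (1 - (p : ℂ) ^ (N + 1) / pPow p w)) =
        (1 + (p : ℂ) ^ (2 * N + 1)) * P - (p : ℂ) ^ N * pPow p w * P -
          (p : ℂ) ^ (N + 1) / pPow p w * P := fun P => by
      field_simp
      ring
    rw [hv]
    refine (congrArg (HasSum · _) (funext fun n => ?_)).mpr h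
    simp only [Function.comp, Equiv.coe_addRight, ← sub_eq_add_neg]
    have e1 := tripleTerm_mul_pPow hp0 w n
    have e2 := tripleTerm_div_pPow hp0 w n
    set a : ℂ := (p : ℂ) ^ ((N : ℤ) + 1 - n) with ha
    set b : ℂ := (p : ℂ) ^ ((N : ℤ) + 1 + n) with hb
    have hab : a * b = (p : ℂ) ^ (2 * N + 2) := by
      rw [ha, hb, ← zpow_add₀ hp, ← zpow_natCast]; congr 1; push_cast; ring
    have ha' : (p : ℂ) ^ ((N : ℤ) - n) = a / p := by
      rw [ha, eq_div_iff hp, ← zpow_add_one₀ hp]; congr 1; ring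
    have hb' : (p : ℂ) ^ ((N : ℤ) + n) = b / p := by
      rw [hb, eq_div_iff hp, ← zpow_add_one₀ hp]; congr 1; ring
    have ca : (p : ℂ) ^ N * (p / (p : ℂ) ^ n) = a := by
      rw [ha, zpow_sub₀ hp, zpow_add_one₀ hp, zpow_natCast]; ring
    have cb : (p : ℂ) ^ (N + 1) * (p : ℂ) ^ n = b := by
      rw [hb, zpow_add₀ hp, zpow_add_one₀ hp, zpow_natCast]; ring
    have r1 : rpoch p ((N : ℤ) - n) = (1 - a) * rpoch p ((N : ℤ) + 1 - n) := by
      rw [← rpoch_sub_one hp0 hp1]; congr 1; ring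
    have r2 : rpoch p ((N : ℤ) + n) = (1 - b) * rpoch p ((N : ℤ) + 1 + n) := by
      rw [← rpoch_sub_one hp0 hp1]; congr 1; ring
    have r3 : rpoch p ((N : ℤ) - (n + 1)) =
        (1 - a / p) * ((1 - a) * rpoch p ((N : ℤ) + 1 - n)) := by
      rw [← r1, ← ha', ← rpoch_sub_one hp0 hp1]; congr 1; ring
    have r4 : rpoch p ((N : ℤ) + (n - 1)) =
        (1 - b / p) * ((1 - b) * rpoch p ((N : ℤ) + 1 + n)) := by
      rw [← r2, ← hb', ← rpoch_sub_one hp0 hp1]; congr 1; ring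
    have r5 : (N : ℤ) - (n - 1) = N + 1 - n := by ring
    have r6 : (N : ℤ) + (n + 1) = N + 1 + n := by ring
    have r7 : poch p (2 * (N + 1)) = poch p (2 * N) * (1 - a * b / p) * (1 - a * b) := by
      rw [show 2 * (N + 1) = 2 * N + 1 + 1 by ring, poch, Finset.prod_range_succ,
        Finset.prod_range_succ, ← poch, hab]
      field_simp
      ring
    have r8 : (p : ℂ) ^ (2 * N + 1) = a * b / p := by
      rw [hab]; field_simp; ring
    rw [r1, r2, r3, r4, r5, r6, r7, r8]
    push_cast
    generalize rpoch p ((N : ℤ) + 1 - n) = r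
    generalize rpoch p ((N : ℤ) + 1 + n) = r'
    generalize poch p (2 * N) = P
    have f1 : (p : ℂ) ^ N * pPow p w * (P * r * ((1 - b / p) * ((1 - b) * r')) *
        tripleTerm p w (n - 1)) =
        -(a * (P * r * ((1 - b / p) * ((1 - b) * r')) * tripleTerm p w n)) := by
      rw [← ca]
      linear_combination (p : ℂ) ^ N * (P * r * ((1 - b / p) * ((1 - b) * r'))) * e1
    have f2 : (p : ℂ) ^ (N + 1) / pPow p w * (P * ((1 - a / p) * ((1 - a) * r)) * r' *
        tripleTerm p w (n + 1)) =
        -(b * (P * ((1 - a / p) * ((1 - a) * r)) * r' * tripleTerm p w n)) := by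
      rw [← cb]
      linear_combination (p : ℂ) ^ (N + 1) * (P * ((1 - a / p) * ((1 - a) * r)) * r') * e2
    rw [f1, f2]
    field_simp
    ring

/-- The Jacobi triple product, up to normalisation. -/
lemma exists_theta_eq_tsum {p : ℝ} (hp0 : 0 < p) (hp1 : p < 1) :
    ∃ C : ℂ, ∀ w : ℂ, theta p (pPow p w) = C * ∑' n : ℤ, tripleTerm p w n := by
  obtain ⟨Q, hQ, hlim⟩ := exists_tendsto_poch hp0 hp1
  have hinv : Filter.Tendsto (fun n => (poch p n)⁻¹) Filter.atTop (nhds Q⁻¹) := hlim.inv₀ hQ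
  refine ⟨Q * Q⁻¹ * Q⁻¹, fun w => ?_⟩
  have hprod : Filter.Tendsto (fun N : ℕ => ∏ m ∈ Finset.range N,
      ((1 - (p : ℂ) ^ m * pPow p w) * (1 - (p : ℂ) ^ (m + 1) / pPow p w)))
      Filter.atTop (nhds (theta p (pPow p w))) := by
    have hg : Summable fun m : ℕ => p ^ m := summable_geometric_of_lt_one hp0.le hp1
    have m1 : Multipliable fun m : ℕ => 1 + -((p : ℂ) ^ m * pPow p w) := by
      refine multipliable_one_add_of_summable ?_
      simpa [abs_of_pos hp0] using hg.mul_right ‖pPow p w‖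
    have m2 : Multipliable fun m : ℕ => 1 + -((p : ℂ) ^ (m + 1) / pPow p w) := by
      refine multipliable_one_add_of_summable ?_
      simpa [abs_of_pos hp0] using ((summable_nat_add_iff 1).2 hg).div_const ‖pPow p w‖
    unfold theta
    simpa only [← sub_eq_add_neg] using (m1.mul m2).hasProd.tendsto_prod_nat
  obtain ⟨K, hK⟩ : ∃ K, ∀ n, ‖poch p n‖ ≤ K := by
    obtain ⟨K, hK⟩ := hlim.norm.bddAbove_range
    exact ⟨K, fun n => hK ⟨n, rfl⟩⟩
  obtain ⟨M, hM⟩ : ∃ M, ∀ k, ‖rpoch p k‖ ≤ M := by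
    obtain ⟨M, hM⟩ := hinv.norm.bddAbove_range
    refine ⟨M, fun k => ?_⟩
    rw [rpoch]
    split_ifs
    · simpa using (norm_nonneg _).trans (hM ⟨0, rfl⟩)
    · exact hM ⟨_, rfl⟩
  have hK0 : 0 ≤ K := (norm_nonneg _).trans (hK 0)
  have hM0 : 0 ≤ M := (norm_nonneg _).trans (hM 0)
  have hr : Filter.Tendsto (rpoch p) Filter.atTop (nhds Q⁻¹) := by
    have ht : Filter.Tendsto Int.toNat Filter.atTop Filter.atTop :=
      Filter.tendsto_atTop.2 fun b => (Filter.eventually_ge_atTop (b : ℤ)).mono fun k hk => by omega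
    refine (hinv.comp ht).congr' ?_
    filter_upwards [Filter.eventually_ge_atTop (0 : ℤ)] with k hk
    simp [rpoch, not_lt.2 hk]
  have hN : Filter.Tendsto (fun N : ℕ => (N : ℤ)) Filter.atTop Filter.atTop :=
    tendsto_natCast_atTop_atTop
  have hsum : Filter.Tendsto (fun N : ℕ => ∑' n : ℤ,
      poch p (2 * N) * rpoch p (N - n) * rpoch p (N + n) * tripleTerm p w n) Filter.atTop
      (nhds (∑' n : ℤ, Q * Q⁻¹ * Q⁻¹ * tripleTerm p w n)) := by
    refine tendsto_tsum_of_dominated_convergence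
      (bound := fun n => K * M * M * ‖tripleTerm p w n‖)
      ((summable_tripleTerm hp0 hp1 w).norm.mul_left _) (fun n => ?_)
      (Filter.Eventually.of_forall fun N n => ?_)
    · have t0 : Filter.Tendsto (fun N : ℕ => 2 * N) Filter.atTop Filter.atTop :=
        Filter.tendsto_id.const_mul_atTop' two_pos
      have t1 : Filter.Tendsto (fun N : ℕ => (N : ℤ) - n) Filter.atTop Filter.atTop := by
        simpa only [sub_eq_add_neg] using Filter.tendsto_atTop_add_const_right _ (-n) hN
      have t2 : Filter.Tendsto (fun N : ℕ => (N : ℤ) + n) Filter.atTop Filter.atTop :=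
        Filter.tendsto_atTop_add_const_right _ n hN
      exact (((hlim.comp t0).mul (hr.comp t1)).mul (hr.comp t2)).mul_const _
    · rw [norm_mul, norm_mul, norm_mul]
      gcongr
      exacts [hK _, hM _, hM _]
  rw [← tsum_mul_left]
  refine tendsto_nhds_unique hprod (hsum.congr fun N => ?_)
  exact (hasSum_finite_tripleProduct hp0 hp1 w N).tsum_eq

/-! ### The odd theta function and its three-term relation -/

/-- The normalisation `p^{-w/2} θ(p^w;p)`, an odd function of `w`. -/
def oddTheta (p : ℝ) (w : ℂ) : ℂ := pPow p (-w / 2) * theta p (pPow p w)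

lemma theta_pPow (p : ℝ) (w : ℂ) : theta p (pPow p w) = pPow p (w / 2) * oddTheta p w := by
  rw [oddTheta, ← mul_assoc, ← pPow_add, show w / 2 + -w / 2 = 0 by ring, pPow_zero, one_mul]

/-- The series `∑ p^{r² + b r + c}`. -/
def latticeGaussSum (p : ℝ) (b c : ℂ) : ℂ := ∑' r : ℤ, pPow p (((1 : ℝ) : ℂ) * r ^ 2 + b * r + c)

lemma latticeGaussSum_shift (p : ℝ) (b : ℂ) :
    latticeGaussSum p (2 * b + 1) b = latticeGaussSum p (2 * b - 1) (-b) := by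
  rw [latticeGaussSum, latticeGaussSum, ← (Equiv.addRight (-1 : ℤ)).tsum_eq]
  refine tsum_congr fun r => congrArg _ ?_
  simp only [Equiv.coe_addRight]
  push_cast
  ring

lemma hasSum_gauss_mul {p : ℝ} (hp0 : 0 < p) (hp1 : p < 1) (b c b' c' : ℂ) :
    HasSum (fun z : ℤ × ℤ => pPow p (((1 : ℝ) : ℂ) * z.1 ^ 2 + b * z.1 + c) *
      pPow p (((1 : ℝ) : ℂ) * z.2 ^ 2 + b' * z.2 + c')) (latticeGaussSum p b c * latticeGaussSum p b' c') := by
  have h1 := (summable_pPow_gaussian hp0 hp1 one_pos b c).norm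
  have h2 := (summable_pPow_gaussian hp0 hp1 one_pos b' c').norm
  rw [latticeGaussSum, latticeGaussSum, tsum_mul_tsum_of_summable_norm h1 h2]
  exact (summable_mul_of_summable_norm h1 h2).hasSum

/-- The pairs of integers split according to the parity of their sum. -/
def parityEquiv : (ℤ × ℤ) ⊕ (ℤ × ℤ) ≃ ℤ × ℤ :=
  Equiv.ofBijective
    (Sum.elim (fun z => (z.1 + z.2, z.1 - z.2)) (fun z => (z.1 + z.2 + 1, z.1 - z.2))) <| by
  constructor
  · rintro (⟨a, b⟩ | ⟨a, b⟩) (⟨c, d⟩ | ⟨c, d⟩) h <;>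
      simp only [Sum.elim_inl, Sum.elim_inr, Prod.mk.injEq, Sum.inl.injEq, Sum.inr.injEq] at h ⊢ <;>
      omega
  · rintro ⟨m, n⟩
    rcases Int.even_or_odd' (m + n) with ⟨k, hk | hk⟩
    · exact ⟨.inl (k, k - n), by simp only [Sum.elim_inl, Prod.mk.injEq]; omega⟩
    · exact ⟨.inr (k, k - n), by simp only [Sum.elim_inr, Prod.mk.injEq]; omega⟩

lemma tripleTerm_mul_even (p : ℝ) (a b : ℂ) (r j : ℤ) :
    pPow p (-a) * (tripleTerm p (a + b) (r + j) * tripleTerm p (a - b) (r - j)) =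
      pPow p (((1 : ℝ) : ℂ) * r ^ 2 + (2 * a - 1) * r + -a) *
        pPow p (((1 : ℝ) : ℂ) * j ^ 2 + 2 * b * j + 0) := by
  have h : (-1 : ℂ) ^ (r + j) * (-1) ^ (r - j) = 1 := by
    rw [← zpow_add₀ (by norm_num), show r + j + (r - j) = 2 * r by ring, zpow_mul]; norm_num
  rw [tripleTerm, tripleTerm, mul_mul_mul_comm, h, one_mul, ← pPow_add, ← pPow_add, ← pPow_add]
  congr 1
  push_cast
  ring

lemma tripleTerm_mul_odd (p : ℝ) (a b : ℂ) (r j : ℤ) :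
    pPow p (-a) * (tripleTerm p (a + b) (r + j + 1) * tripleTerm p (a - b) (r - j)) =
      -(pPow p (((1 : ℝ) : ℂ) * r ^ 2 + 2 * a * r + 0) *
        pPow p (((1 : ℝ) : ℂ) * j ^ 2 + (2 * b + 1) * j + b)) := by
  have h : (-1 : ℂ) ^ (r + j + 1) * (-1) ^ (r - j) = -1 := by
    rw [← zpow_add₀ (by norm_num), show r + j + 1 + (r - j) = 2 * r + 1 by ring,
      zpow_add_one₀ (by norm_num), zpow_mul]; norm_num
  rw [tripleTerm, tripleTerm, mul_mul_mul_comm, h, neg_one_mul, mul_neg, ← pPow_add, ← pPow_add,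
    ← pPow_add]
  congr 2
  push_cast
  ring

/-- Riemann's addition formula: `s(a+b)s(a-b)` has rank two. -/
lemma exists_oddTheta_add_mul_sub {p : ℝ} (hp0 : 0 < p) (hp1 : p < 1) :
    ∃ f g : ℂ → ℂ, ∀ a b : ℂ,
      oddTheta p (a + b) * oddTheta p (a - b) = f a * g b - g a * f b := by
  obtain ⟨C, hC⟩ := exists_theta_eq_tsum hp0 hp1
  refine ⟨fun a => C ^ 2 * latticeGaussSum p (2 * a - 1) (-a), fun a => latticeGaussSum p (2 * a) 0,
    fun a b => ?_⟩
  have h1 := (summable_tripleTerm hp0 hp1 (a + b)).norm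
  have h2 := (summable_tripleTerm hp0 hp1 (a - b)).norm
  have key : pPow p (-a) * ((∑' n, tripleTerm p (a + b) n) * ∑' n, tripleTerm p (a - b) n) =
      latticeGaussSum p (2 * a - 1) (-a) * latticeGaussSum p (2 * b) 0 -
        latticeGaussSum p (2 * a) 0 * latticeGaussSum p (2 * b - 1) (-b) := by
    rw [tsum_mul_tsum_of_summable_norm h1 h2, ← tsum_mul_left, ← parityEquiv.tsum_eq,
      ← latticeGaussSum_shift p b]
    apply HasSum.tsum_eq
    rw [sub_eq_add_neg (latticeGaussSum p (2 * a - 1) (-a) * _)]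
    apply HasSum.sum
    · refine (congrArg (HasSum · _) (funext fun z => ?_)).mpr
        (hasSum_gauss_mul hp0 hp1 (2 * a - 1) (-a) (2 * b) 0)
      exact tripleTerm_mul_even p a b z.1 z.2
    · refine (congrArg (HasSum · _) (funext fun z => ?_)).mpr
        (hasSum_gauss_mul hp0 hp1 (2 * a) 0 (2 * b + 1) b).neg
      exact tripleTerm_mul_odd p a b z.1 z.2
  have hpow : pPow p (-(a + b) / 2) * pPow p (-(a - b) / 2) = pPow p (-a) := by
    rw [← pPow_add]; congr 1; ring
  rw [oddTheta, oddTheta, hC, hC]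
  linear_combination C ^ 2 * key + C ^ 2 * (∑' n, tripleTerm p (a + b) n) *
    (∑' n, tripleTerm p (a - b) n) * hpow

lemma oddTheta_neg {p : ℝ} (hp0 : 0 < p) (hp1 : p < 1) (w : ℂ) :
    oddTheta p (-w) = -oddTheta p w := by
  obtain ⟨f, g, h⟩ := exists_oddTheta_add_mul_sub hp0 hp1
  have key : ∀ c d : ℂ, oddTheta p c * (oddTheta p (-d) + oddTheta p d) = 0 := fun c d => by
    have h1 := h ((c + d) / 2) ((c - d) / 2)
    have h2 := h ((c - d) / 2) ((c + d) / 2)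
    ring_nf at h1 h2 ⊢
    linear_combination h1 + h2
  by_cases hw : oddTheta p w = 0
  · have := key (-w) w
    rw [hw, add_zero, mul_self_eq_zero] at this
    rw [this, hw, neg_zero]
  · exact eq_neg_of_add_eq_zero_left ((mul_eq_zero.1 (key w w)).resolve_left hw)

/-- The three-term (Weierstrass) relation. -/
lemma oddTheta_three_term {p : ℝ} (hp0 : 0 < p) (hp1 : p < 1) (a b c d : ℂ) :
    oddTheta p (a + b) * oddTheta p (a - b) * (oddTheta p (c + d) * oddTheta p (c - d)) -
      oddTheta p (a + c) * oddTheta p (a - c) * (oddTheta p (b + d) * oddTheta p (b - d)) +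
      oddTheta p (a + d) * oddTheta p (a - d) * (oddTheta p (b + c) * oddTheta p (b - c)) = 0 := by
  obtain ⟨f, g, h⟩ := exists_oddTheta_add_mul_sub hp0 hp1
  simp only [h]
  ring

lemma oddTheta_five_variable {p : ℝ} (hp0 : 0 < p) (hp1 : p < 1) (u v x y : ℂ) :
    oddTheta p u * oddTheta p (v - y) * oddTheta p (x + y) * oddTheta p (u + v - x) =
      oddTheta p (u + v) * oddTheta p (u - x) * oddTheta p (v - (x + y)) * oddTheta p y +
        oddTheta p v * oddTheta p x * oddTheta p (u + v - (x + y)) * oddTheta p (u + y) := by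
  have h := oddTheta_three_term hp0 hp1 ((u + v - y) / 2) ((u - v + y) / 2) ((u + v + y) / 2)
    ((u + v - y) / 2 - x)
  rw [show (u + v - y) / 2 + (u - v + y) / 2 = u by ring,
    show (u + v - y) / 2 - (u - v + y) / 2 = v - y by ring,
    show (u + v + y) / 2 + ((u + v - y) / 2 - x) = u + v - x by ring,
    show (u + v + y) / 2 - ((u + v - y) / 2 - x) = x + y by ring,
    show (u + v - y) / 2 + (u + v + y) / 2 = u + v by ring,
    show (u + v - y) / 2 - (u + v + y) / 2 = -y by ring,
    show (u - v + y) / 2 + ((u + v - y) / 2 - x) = u - x by ring,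
    show (u - v + y) / 2 - ((u + v - y) / 2 - x) = -(v - (x + y)) by ring,
    show (u + v - y) / 2 + ((u + v - y) / 2 - x) = u + v - (x + y) by ring,
    show (u + v - y) / 2 - ((u + v - y) / 2 - x) = x by ring,
    show (u - v + y) / 2 + (u + v + y) / 2 = u + y by ring,
    show (u - v + y) / 2 - (u + v + y) / 2 = -v by ring] at h
  simp only [oddTheta_neg hp0 hp1] at h
  linear_combination h

lemma oddTheta_antisymm {p : ℝ} (hp0 : 0 < p) (hp1 : p < 1) (u v x y : ℂ) :
    oddTheta p (u - x) * oddTheta p (u - y) * oddTheta p (v - (x + y)) * oddTheta p v -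
        oddTheta p (v - x) * oddTheta p (v - y) * oddTheta p (u - (x + y)) * oddTheta p u =
      oddTheta p x * oddTheta p y * oddTheta p (u + v - (x + y)) * oddTheta p (v - u) := by
  have h := oddTheta_three_term hp0 hp1 ((u + v - x) / 2) ((v - u + x) / 2) ((u - v + x) / 2)
    ((u + v - x) / 2 - y)
  rw [show (u + v - x) / 2 + (v - u + x) / 2 = v by ring,
    show (u + v - x) / 2 - (v - u + x) / 2 = u - x by ring,
    show (u - v + x) / 2 + ((u + v - x) / 2 - y) = u - y by ring,
    show (u - v + x) / 2 - ((u + v - x) / 2 - y) = -(v - (x + y)) by ring,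
    show (u + v - x) / 2 + (u - v + x) / 2 = u by ring,
    show (u + v - x) / 2 - (u - v + x) / 2 = v - x by ring,
    show (v - u + x) / 2 + ((u + v - x) / 2 - y) = v - y by ring,
    show (v - u + x) / 2 - ((u + v - x) / 2 - y) = -(u - (x + y)) by ring,
    show (u + v - x) / 2 + ((u + v - x) / 2 - y) = u + v - (x + y) by ring,
    show (u + v - x) / 2 - ((u + v - x) / 2 - y) = y by ring,
    show (v - u + x) / 2 + (u - v + x) / 2 = x by ring,
    show (v - u + x) / 2 - (u - v + x) / 2 = v - u by ring] at h
  simp only [oddTheta_neg hp0 hp1] at h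
  linear_combination -h

lemma oddTheta_six_variable {p : ℝ} (hp0 : 0 < p) (hp1 : p < 1) (t u v x y : ℂ) :
    oddTheta p t ^ 2 *
        (oddTheta p (u - x) * oddTheta p (u - y) * oddTheta p (v - (x + y)) * oddTheta p v -
          oddTheta p (v - x) * oddTheta p (v - y) * oddTheta p (u - (x + y)) * oddTheta p u) *
        oddTheta p (u + v) =
      oddTheta p x * oddTheta p y * oddTheta p (u + v - (x + y)) *
        (oddTheta p (t - u) * oddTheta p (t + u) * oddTheta p v ^ 2 -
          oddTheta p (t - v) * oddTheta p (t + v) * oddTheta p u ^ 2) := by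
  have h := oddTheta_three_term hp0 hp1 t u v 0
  simp only [add_zero, sub_zero] at h
  have h' := oddTheta_neg hp0 hp1 (u - v)
  rw [neg_sub] at h'
  rw [oddTheta_antisymm hp0 hp1, h', add_comm u v] at *
  linear_combination (-(oddTheta p x * oddTheta p y * oddTheta p (v + u - (x + y)))) * h

/-! ### Matrix coefficients -/

/-- The coefficient `A^y(x)` in terms of the odd theta function, with `t = 2κ`. -/
def aCoef (p : ℝ) (t y x : ℂ) : ℂ :=
  oddTheta p t * oddTheta p (y - x) / (oddTheta p y * oddTheta p (t - x)) *
    (pPow p (t * x) / pPow p (y * x))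

/-- The part of the coefficient `B^y(x)` depending on `x`, with `t = 2κ`. -/
def bCoef (p : ℝ) (t x : ℂ) : ℂ := oddTheta p x / oddTheta p (t - x) * pPow p (t * x)

/-- The part of the coefficient `B^y(x)` depending on `y`, with `t = 2κ`. -/
def bGauge (p : ℝ) (t y : ℂ) : ℂ := oddTheta p (t - y) / oddTheta p y / pPow p (t * y)

lemma Afun_eq (p : ℝ) (κ y x : ℂ) : Afun p κ y x = aCoef p (2 * κ) y x := by
  have h : pPow p (2 * κ / 2) * pPow p ((y - x) / 2) =
      pPow p (y / 2) * pPow p ((2 * κ - x) / 2) := by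
    rw [← pPow_add, ← pPow_add]; congr 1; ring
  rw [Afun, aCoef, theta_pPow, theta_pPow, theta_pPow, theta_pPow, sub_mul, pPow_sub,
    mul_mul_mul_comm, h, mul_mul_mul_comm (pPow p (y / 2)) (oddTheta p y),
    mul_div_mul_left _ _ (mul_ne_zero (pPow_ne_zero _ _) (pPow_ne_zero _ _))]

lemma Bfun_eq {p : ℝ} (hp0 : 0 < p) (hp1 : p < 1) (κ y x : ℂ) :
    Bfun p κ y x = bCoef p (2 * κ) x * bGauge p (2 * κ) y := by
  have h : pPow p ((2 * κ - y) / 2) * pPow p (-x / 2) =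
      pPow p ((2 * κ - x) / 2) * pPow p (-y / 2) := by
    rw [← pPow_add, ← pPow_add]; congr 1; ring
  rw [Bfun, bCoef, bGauge, theta_pPow, theta_pPow, theta_pPow, theta_pPow, mul_sub, pPow_sub,
    mul_mul_mul_comm, h,
    mul_mul_mul_comm (pPow p ((2 * κ - x) / 2)) (oddTheta p (2 * κ - x)),
    mul_div_mul_left _ _ (mul_ne_zero (pPow_ne_zero _ _) (pPow_ne_zero _ _)),
    oddTheta_neg hp0 hp1, oddTheta_neg hp0 hp1, mul_neg, mul_neg, neg_div_neg_eq]
  simp only [div_eq_mul_inv, mul_inv]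
  ring

lemma cfun_div_cfun_neg {p : ℝ} (hp0 : 0 < p) (hp1 : p < 1) (κ : ℂ) {x : ℂ}
    (hx : oddTheta p x ≠ 0) :
    -(cfun p κ x / cfun p κ (-x)) =
      oddTheta p (2 * κ + x) / oddTheta p (2 * κ - x) * pPow p (2 * κ * x) ^ 2 := by
  have h : pPow p ((2 * κ + x) / 2) = pPow p ((2 * κ - x) / 2) * pPow p (x / 2) ^ 2 := by
    rw [sq, ← pPow_add, ← pPow_add]; congr 1; ring
  have h' : pPow p (-x / 2) = (pPow p (x / 2))⁻¹ := by rw [neg_div, pPow_neg]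
  have := pPow_ne_zero p ((2 * κ - x) / 2)
  have := pPow_ne_zero p (x / 2)
  have := pPow_ne_zero p (2 * κ * x)
  rw [cfun, cfun, theta_pPow, theta_pPow, theta_pPow, theta_pPow, mul_neg, pPow_neg,
    oddTheta_neg hp0 hp1, ← sub_eq_add_neg, h, h']
  generalize pPow p (x / 2) = e at *
  by_cases h0 : oddTheta p (2 * κ - x) = 0
  · simp [h0]
  · field_simp

lemma bGauge_mul_bGauge_neg {p : ℝ} (hp0 : 0 < p) (hp1 : p < 1) (t v : ℂ) :
    bGauge p t v * bGauge p t (-v) =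
      -(oddTheta p (t - v) * oddTheta p (t + v)) / oddTheta p v ^ 2 := by
  rw [bGauge, bGauge, oddTheta_neg hp0 hp1, mul_neg, pPow_neg, sub_neg_eq_add]
  have := pPow_ne_zero p (t * v)
  by_cases h : oddTheta p v = 0
  · simp [h]
  · field_simp

section CoefficientIdentities

variable {p : ℝ} (hp0 : 0 < p) (hp1 : p < 1) {t u v x y : ℂ}
  (hx : oddTheta p (t - x) ≠ 0) (hy : oddTheta p (t - y) ≠ 0)
  (hxy : oddTheta p (t - (x + y)) ≠ 0) (hv : oddTheta p v ≠ 0)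

include hp0 hp1 hx hy hxy hv

lemma aCoef_fusion (hvt : oddTheta p (v + t) ≠ 0) :
    aCoef p t v (x + y) = aCoef p t v x * aCoef p t v y + bCoef p t x * bCoef p t y *
      (bGauge p t v * bGauge p t (-v)) * aCoef p t (v + t) (x + y) := by
  have h := oddTheta_antisymm hp0 hp1 t v x y
  have h' := oddTheta_neg hp0 hp1 (t - v)
  rw [neg_sub] at h'
  rw [h', add_comm t v] at h
  simp only [bGauge_mul_bGauge_neg hp0 hp1, aCoef, bCoef, mul_add, add_mul, pPow_add, add_comm t v]
  have := pPow_ne_zero p (t * x)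
  have := pPow_ne_zero p (t * y)
  have := pPow_ne_zero p (v * x)
  have := pPow_ne_zero p (v * y)
  generalize pPow p (t * x) = e₁ at *
  generalize pPow p (t * y) = e₂ at *
  generalize pPow p (v * x) = e₃ at *
  generalize pPow p (v * y) = e₄ at *
  field_simp
  linear_combination oddTheta p t * h

lemma aCoef_bCoef_fusion (hvt : oddTheta p (v + t) ≠ 0) :
    bCoef p t (x + y) * aCoef p t (v + t) x =
      bCoef p t y * aCoef p t v x +
        bCoef p t x * aCoef p t (-v) y * aCoef p t (v + t) (x + y) := by
  have h := oddTheta_five_variable hp0 hp1 v t x y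
  have h' : oddTheta p (-v - y) = -oddTheta p (v + y) := by
    rw [← oddTheta_neg hp0 hp1, neg_add']
  simp only [aCoef, bCoef, mul_add, add_mul, neg_mul, pPow_add, pPow_neg, h',
    oddTheta_neg hp0 hp1]
  have := pPow_ne_zero p (t * x)
  have := pPow_ne_zero p (t * y)
  have := pPow_ne_zero p (v * x)
  have := pPow_ne_zero p (v * y)
  generalize pPow p (t * x) = e₁ at *
  generalize pPow p (t * y) = e₂ at *
  generalize pPow p (v * x) = e₃ at *
  generalize pPow p (v * y) = e₄ at *
  field_simp
  linear_combination oddTheta p t * h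

lemma aCoef_exchange_shift (hvt : oddTheta p (v + t) ≠ 0) :
    aCoef p t (v + t) x * aCoef p t (v + t) y * aCoef p t (-v) (x + y) +
        bCoef p t x * bCoef p t y * (bGauge p t (v + t) * bGauge p t (-(v + t))) =
      aCoef p t (-v) x * aCoef p t (-v) y * aCoef p t (v + t) (x + y) +
        bCoef p t x * bCoef p t y * (bGauge p t v * bGauge p t (-v)) := by
  have h := oddTheta_six_variable hp0 hp1 t (v + t) (-v) x y
  rw [add_neg_cancel_comm, sub_neg_eq_add, ← sub_eq_add_neg] at h
  simp only [bGauge_mul_bGauge_neg hp0 hp1]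
  simp only [aCoef, bCoef, mul_add, add_mul, neg_mul, pPow_add, pPow_neg, oddTheta_neg hp0 hp1]
    at h ⊢
  have := pPow_ne_zero p (t * x)
  have := pPow_ne_zero p (t * y)
  have := pPow_ne_zero p (v * x)
  have := pPow_ne_zero p (v * y)
  generalize pPow p (t * x) = e₁ at *
  generalize pPow p (t * y) = e₂ at *
  generalize pPow p (v * x) = e₃ at *
  generalize pPow p (v * y) = e₄ at *
  field_simp
  linear_combination h

variable (hu : oddTheta p u ≠ 0) (huv : oddTheta p (u + v) ≠ 0)

include hu huv

lemma aCoef_exchange :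
    aCoef p t u x * aCoef p t u y * aCoef p t v (x + y) +
        bCoef p t x * bCoef p t y * (bGauge p t u * bGauge p t (-u)) *
          aCoef p t (u + v) (x + y) =
      aCoef p t v x * aCoef p t v y * aCoef p t u (x + y) +
        bCoef p t x * bCoef p t y * (bGauge p t v * bGauge p t (-v)) *
          aCoef p t (u + v) (x + y) := by
  have h := oddTheta_six_variable hp0 hp1 t u v x y
  simp only [bGauge_mul_bGauge_neg hp0 hp1]
  simp only [aCoef, bCoef, mul_add, add_mul, pPow_add]
  have := pPow_ne_zero p (t * x)
  have := pPow_ne_zero p (t * y)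
  have := pPow_ne_zero p (v * x)
  have := pPow_ne_zero p (v * y)
  generalize pPow p (t * x) = e₁ at *
  generalize pPow p (t * y) = e₂ at *
  generalize pPow p (v * x) = e₃ at *
  generalize pPow p (v * y) = e₄ at *
  have := pPow_ne_zero p (u * x)
  have := pPow_ne_zero p (u * y)
  generalize pPow p (u * x) = e₅ at *
  generalize pPow p (u * y) = e₆ at *
  field_simp
  linear_combination oddTheta p t * h

lemma aCoef_bCoef_exchange :
    bCoef p t (x + y) * aCoef p t u y * aCoef p t (u + v) x =
      bCoef p t y * aCoef p t v x * aCoef p t u (x + y) +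
        bCoef p t x * aCoef p t (u + v) (x + y) * aCoef p t (-v) y := by
  have h := oddTheta_five_variable hp0 hp1 v u x y
  have h' : oddTheta p (-v - y) = -oddTheta p (v + y) := by
    rw [← oddTheta_neg hp0 hp1, neg_add']
  rw [add_comm v u] at h
  simp only [aCoef, bCoef, mul_add, add_mul, neg_mul, pPow_add, pPow_neg, h',
    oddTheta_neg hp0 hp1]
  have := pPow_ne_zero p (t * x)
  have := pPow_ne_zero p (t * y)
  have := pPow_ne_zero p (v * x)
  have := pPow_ne_zero p (v * y)
  generalize pPow p (t * x) = e₁ at *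
  generalize pPow p (t * y) = e₂ at *
  generalize pPow p (v * x) = e₃ at *
  generalize pPow p (v * y) = e₄ at *
  have := pPow_ne_zero p (u * x)
  have := pPow_ne_zero p (u * y)
  generalize pPow p (u * x) = e₅ at *
  generalize pPow p (u * y) = e₆ at *
  field_simp
  linear_combination oddTheta p t ^ 2 * h

end CoefficientIdentities

lemma oddTheta_ne_zero {p : ℝ} {w : ℂ} (h : theta p (pPow p w) ≠ 0) : oddTheta p w ≠ 0 :=
  right_ne_zero_of_mul (theta_pPow p w ▸ h)

lemma sgn3_mul_self (i : Fin 3) : sgn3 i * sgn3 i = 1 := by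
  unfold sgn3; split_ifs <;> norm_num

lemma sgn3_eq_one_or_neg_one (i : Fin 3) : sgn3 i = 1 ∨ sgn3 i = -1 := by
  unfold sgn3; split_ifs <;> simp

/-- The coefficient of `R(x;φ)` on `v_i ⊗ v_i`. -/
def diagCoef (p : ℝ) (κ x : ℂ) (i : Fin 3) : ℂ := sgn3 i * (cfun p κ x / cfun p κ (sgn3 i * x))

lemma diagCoef_of_sgn_eq_one {p : ℝ} {κ x : ℂ} (hx : oddTheta p x ≠ 0)
    (hadd : oddTheta p (2 * κ + x) ≠ 0) {i : Fin 3} (h : sgn3 i = 1) : diagCoef p κ x i = 1 := by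
  rw [diagCoef, h, one_mul, one_mul, div_self]
  rw [cfun, theta_pPow, theta_pPow]
  simp [pPow_ne_zero, hx, hadd]

section ParityCoefficients

variable {p : ℝ} (hp0 : 0 < p) (hp1 : p < 1) {κ x : ℂ} (hx : oddTheta p x ≠ 0)
  (hadd : oddTheta p (2 * κ + x) ≠ 0) (hsub : oddTheta p (2 * κ - x) ≠ 0)

include hp0 hp1 hadd hsub

lemma oddTheta_sgn_sub_ne_zero (i : Fin 3) : oddTheta p (2 * κ * sgn3 i - x) ≠ 0 := by
  rcases sgn3_eq_one_or_neg_one i with h | h <;> rw [h]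
  · rwa [mul_one]
  · rwa [mul_neg_one, ← neg_add', oddTheta_neg hp0 hp1, neg_ne_zero]

include hx

lemma Afun_eq_diagCoef_mul (i : Fin 3) (y : ℂ) :
    Afun p κ y x = diagCoef p κ x i * aCoef p (2 * κ * sgn3 i) y x := by
  rw [Afun_eq]
  rcases sgn3_eq_one_or_neg_one i with h | h
  · rw [diagCoef_of_sgn_eq_one hx hadd h, h, mul_one, one_mul]
  · rw [diagCoef, h, neg_one_mul, neg_one_mul, cfun_div_cfun_neg hp0 hp1 κ hx, mul_neg_one, aCoef,
      aCoef, ← neg_add', oddTheta_neg hp0 hp1, oddTheta_neg hp0 hp1, neg_mul (2 * κ) x, pPow_neg]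
    have := pPow_ne_zero p (2 * κ * x)
    generalize pPow p (2 * κ * x) = e at *
    field_simp

lemma Bfun_eq_diagCoef_mul (i : Fin 3) (y : ℂ) :
    Bfun p κ y x =
      diagCoef p κ x i * bCoef p (2 * κ * sgn3 i) x * (sgn3 i * bGauge p (2 * κ) y) := by
  rw [Bfun_eq hp0 hp1]
  rcases sgn3_eq_one_or_neg_one i with h | h
  · rw [diagCoef_of_sgn_eq_one hx hadd h, h, mul_one, one_mul, one_mul]
  · rw [diagCoef, h, neg_one_mul, neg_one_mul, cfun_div_cfun_neg hp0 hp1 κ hx, mul_neg_one, bCoef,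
      bCoef, ← neg_add', oddTheta_neg hp0 hp1, neg_mul (2 * κ) x, pPow_neg]
    have := pPow_ne_zero p (2 * κ * x)
    generalize pPow p (2 * κ * x) = e at *
    field_simp

end ParityCoefficients

lemma bGauge_sgn {p : ℝ} (hp0 : 0 < p) (hp1 : p < 1) (t y : ℂ) (i : Fin 3) :
    bGauge p (t * sgn3 i) y * bGauge p (t * sgn3 i) (-y) = bGauge p t y * bGauge p t (-y) := by
  rw [bGauge_mul_bGauge_neg hp0 hp1, bGauge_mul_bGauge_neg hp0 hp1]
  rcases sgn3_eq_one_or_neg_one i with h | h <;> rw [h]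
  · rw [mul_one]
  · rw [mul_neg_one, ← neg_add', oddTheta_neg hp0 hp1, neg_add_eq_sub, ← neg_sub t,
      oddTheta_neg hp0 hp1]
    ring

/-! ### Shifts of the dynamical parameter -/

lemma Psi_sub_of_ne (p : ℝ) (α : ℂ) {k a b : Fin 3} (ha : k ≠ a) (hb : k ≠ b) :
    Psi p α k a - Psi p α k b = Psi p 0 0 a - Psi p 0 0 b := by
  fin_cases k <;> fin_cases a <;> fin_cases b <;> simp_all [Psi]

lemma Psi_neg_sub (p : ℝ) (κ : ℂ) {i j : Fin 3} (h : i ≠ j) :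
    Psi p (-κ) i i - Psi p (-κ) i j = Psi p κ i i - Psi p κ i j + 2 * κ * sgn3 i := by
  fin_cases i <;> fin_cases j <;> simp_all [Psi, sgn3] <;> ring

/-! ### Action on basis vectors -/

section Action

open scoped Matrix

lemma R12_mulVec_self (p : ℝ) (κ x : ℂ) (ψ : Fin 3 → Fin 3 → ℂ) (i k : Fin 3) :
    R12 p κ x ψ *ᵥ Pi.single (i, i, k) 1 = diagCoef p κ x i • Pi.single (i, i, k) 1 := by
  rw [Matrix.mulVec_single_one]
  ext ⟨a, b, c⟩
  by_cases hc : c = k <;> by_cases hab : (a, b) = (i, i) <;>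
    simp_all [R12, Rop, diagCoef, Matrix.col_apply]

lemma R23_mulVec_self (p : ℝ) (κ x : ℂ) (ψ : Fin 3 → Fin 3 → ℂ) (i k : Fin 3) :
    R23 p κ x ψ *ᵥ Pi.single (k, i, i) 1 = diagCoef p κ x i • Pi.single (k, i, i) 1 := by
  rw [Matrix.mulVec_single_one]
  ext ⟨c, a, b⟩
  by_cases hc : c = k <;> by_cases hab : (a, b) = (i, i) <;>
    simp_all [R23, Rop, diagCoef, Matrix.col_apply]

lemma R12_mulVec_of_ne (p : ℝ) (κ x : ℂ) (ψ : Fin 3 → Fin 3 → ℂ) {i j : Fin 3} (h : i ≠ j)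
    (k : Fin 3) :
    R12 p κ x ψ *ᵥ Pi.single (i, j, k) 1 =
      Afun p κ (ψ k i - ψ k j) x • Pi.single (i, j, k) 1 +
        (sgn3 i * sgn3 j * Bfun p κ (ψ k i - ψ k j) x) • Pi.single (j, i, k) 1 := by
  rw [Matrix.mulVec_single_one]
  ext ⟨a, b, c⟩
  by_cases hc : c = k <;> simp [R12, Rop, h, hc, Pi.single_apply, Matrix.col_apply]

lemma R23_mulVec_of_ne (p : ℝ) (κ x : ℂ) (ψ : Fin 3 → Fin 3 → ℂ) {i j : Fin 3} (h : i ≠ j)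
    (k : Fin 3) :
    R23 p κ x ψ *ᵥ Pi.single (k, i, j) 1 =
      Afun p κ (ψ k i - ψ k j) x • Pi.single (k, i, j) 1 +
        (sgn3 i * sgn3 j * Bfun p κ (ψ k i - ψ k j) x) • Pi.single (k, j, i) 1 := by
  rw [Matrix.mulVec_single_one]
  ext ⟨c, a, b⟩
  by_cases hc : c = k <;> simp [R23, Rop, h, hc, Pi.single_apply, Matrix.col_apply]

end Action

section YangBaxter

open scoped Matrix

/-- The Yang–Baxter equation on a weight space spanned by permutations of `v_i ⊗ v_i ⊗ v_j`. -/
lemma yangBaxter_of_two_labels {n : Type*} [Fintype n] {p : ℝ} (hp0 : 0 < p) (hp1 : p < 1)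
    {t v x y : ℂ} (S T : ℂ → Matrix n n ℂ) (e₁ e₂ e₃ : n → ℂ) (D g : ℂ → ℂ)
    (ht : ∀ z ∈ ({x, y, x + y} : Set ℂ), oddTheta p (t - z) ≠ 0) (hv : oddTheta p v ≠ 0)
    (hvt : oddTheta p (v + t) ≠ 0) (hg : ∀ z, g z * g (-z) = bGauge p t z * bGauge p t (-z))
    (hS₁ : ∀ z ∈ ({x, y, x + y} : Set ℂ), S z *ᵥ e₁ = D z • e₁)
    (hS₂ : ∀ z ∈ ({x, y, x + y} : Set ℂ), S z *ᵥ e₂ =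
      (D z * aCoef p t (v + t) z) • e₂ + (D z * bCoef p t z * g (v + t)) • e₃)
    (hS₃ : ∀ z ∈ ({x, y, x + y} : Set ℂ), S z *ᵥ e₃ =
      (D z * aCoef p t (-(v + t)) z) • e₃ + (D z * bCoef p t z * g (-(v + t))) • e₂)
    (hT₁ : ∀ z ∈ ({x, y, x + y} : Set ℂ), T z *ᵥ e₁ =
      (D z * aCoef p t v z) • e₁ + (D z * bCoef p t z * g v) • e₂)
    (hT₂ : ∀ z ∈ ({x, y, x + y} : Set ℂ), T z *ᵥ e₂ =
      (D z * aCoef p t (-v) z) • e₂ + (D z * bCoef p t z * g (-v)) • e₁)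
    (hT₃ : ∀ z ∈ ({x, y, x + y} : Set ℂ), T z *ᵥ e₃ = D z • e₃) :
    (S x * T (x + y) * S y) *ᵥ e₁ = (T y * S (x + y) * T x) *ᵥ e₁ ∧
      (S x * T (x + y) * S y) *ᵥ e₂ = (T y * S (x + y) * T x) *ᵥ e₂ ∧
      (S x * T (x + y) * S y) *ᵥ e₃ = (T y * S (x + y) * T x) *ᵥ e₃ := by
  simp only [Set.mem_insert_iff, Set.mem_singleton_iff, forall_eq_or_imp, forall_eq] at *
  obtain ⟨hx, hy, hxy⟩ := ht
  have hyx : oddTheta p (t - (y + x)) ≠ 0 := by rwa [add_comm]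
  have hv' : oddTheta p (-(v + t)) ≠ 0 := by rwa [oddTheta_neg hp0 hp1, neg_ne_zero]
  have hvt' : oddTheta p (-(v + t) + t) ≠ 0 := by
    rwa [neg_add_rev, neg_add_cancel_comm, oddTheta_neg hp0 hp1, neg_ne_zero]
  have hneg : -(v + t) + t = -v := by ring
  have h₁ := aCoef_fusion hp0 hp1 hx hy hxy hv hvt
  have h₂ := aCoef_bCoef_fusion hp0 hp1 hx hy hxy hv hvt
  have h₃ := aCoef_bCoef_fusion hp0 hp1 hy hx hyx hv hvt
  have h₄ := aCoef_exchange_shift hp0 hp1 hx hy hxy hv hvt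
  have h₅ := aCoef_fusion hp0 hp1 hx hy hxy hv' hvt'
  have h₆ := aCoef_bCoef_fusion hp0 hp1 hx hy hxy hv' hvt'
  have h₇ := aCoef_bCoef_fusion hp0 hp1 hy hx hyx hv' hvt'
  have hgv := hg v
  have hgvt := hg (v + t)
  rw [add_comm y x] at h₃ h₇
  simp only [hneg, neg_neg] at h₅ h₆ h₇
  rw [← hgv] at h₁ h₄
  rw [← hgvt] at h₄
  rw [mul_comm (bGauge p t (-(v + t))), ← hgvt] at h₅
  simp only [← Matrix.mulVec_mulVec, Matrix.mulVec_add, Matrix.mulVec_smul, hS₁, hS₂, hS₃, hT₁,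
    hT₂, hT₃]
  refine ⟨?_, ?_, ?_⟩
  · match_scalars
    · linear_combination (D x * D y * D (x + y)) * h₁
    · linear_combination (D x * D y * D (x + y) * g v) * h₂
    · ring
  · match_scalars
    · linear_combination (D x * D y * D (x + y)) * h₄
    · linear_combination (-(D x * D y * D (x + y) * g (v + t))) * h₆
    · linear_combination (D x * D y * D (x + y) * g (-v)) * h₃
  · match_scalars
    · linear_combination (-(D x * D y * D (x + y))) * h₅
    · linear_combination (-(D x * D y * D (x + y) * g (-(v + t)))) * h₇
    · ring

/-- The Yang–Baxter equation on `v_i ⊗ v_j ⊗ v_k` with pairwise distinct `i, j, k`. -/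
lemma yangBaxter_of_three_labels {p : ℝ} (hp0 : 0 < p) (hp1 : p < 1)
    {t x y : ℂ} (S T : ℂ → Matrix (Fin 3 × Fin 3 × Fin 3) (Fin 3 × Fin 3 × Fin 3) ℂ)
    (χ σ : Fin 3 → ℂ)
    (hσ : ∀ i, σ i * σ i = 1)
    (ht : ∀ z ∈ ({x, y, x + y} : Set ℂ), oddTheta p (t - z) ≠ 0)
    (hχ : ∀ i j, i ≠ j → oddTheta p (χ i - χ j) ≠ 0)
    (hS : ∀ z ∈ ({x, y, x + y} : Set ℂ), ∀ i j k, i ≠ j → k ≠ i → k ≠ j →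
      S z *ᵥ Pi.single (i, j, k) 1 = aCoef p t (χ i - χ j) z • Pi.single (i, j, k) 1 +
        (σ i * σ j * (bCoef p t z * bGauge p t (χ i - χ j))) • Pi.single (j, i, k) 1)
    (hT : ∀ z ∈ ({x, y, x + y} : Set ℂ), ∀ i j k, i ≠ j → k ≠ i → k ≠ j →
      T z *ᵥ Pi.single (k, i, j) 1 = aCoef p t (χ i - χ j) z • Pi.single (k, i, j) 1 +
        (σ i * σ j * (bCoef p t z * bGauge p t (χ i - χ j))) • Pi.single (k, j, i) 1)
    {i j k : Fin 3} (hij : i ≠ j) (hjk : j ≠ k) (hik : i ≠ k) :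
    (S x * T (x + y) * S y) *ᵥ Pi.single (i, j, k) 1 =
      (T y * S (x + y) * T x) *ᵥ Pi.single (i, j, k) 1 := by
  simp only [Set.mem_insert_iff, Set.mem_singleton_iff, forall_eq_or_imp, forall_eq] at *
  obtain ⟨hx, hy, hxy⟩ := ht
  have hyx : oddTheta p (t - (y + x)) ≠ 0 := by rwa [add_comm]
  have h₁ := aCoef_exchange hp0 hp1 hx hy hxy (hχ j k hjk) (hχ i j hij)
    (by simpa using hχ i k hik)
  have h₂ := aCoef_bCoef_exchange hp0 hp1 hx hy hxy (hχ j k hjk) (hχ i j hij)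
    (by simpa using hχ i k hik)
  have h₃ := aCoef_bCoef_exchange hp0 hp1 hy hx hyx (hχ i j hij) (hχ j k hjk)
    (by simpa using hχ i k hik)
  rw [add_comm y x] at h₃
  simp only [sub_add_sub_cancel, sub_add_sub_cancel', neg_sub] at h₁ h₂ h₃
  simp only [← Matrix.mulVec_mulVec, Matrix.mulVec_add, Matrix.mulVec_smul, hS, hT, hij, hij.symm,
    hjk, hjk.symm, hik, hik.symm, ne_eq, not_false_eq_true]
  match_scalars
  · linear_combination h₁ +
      bCoef p t x * bCoef p t y * (bGauge p t (χ i - χ j) * bGauge p t (χ j - χ i)) *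
        aCoef p t (χ i - χ k) (x + y) * (σ j * σ j * hσ i + hσ j) -
      bCoef p t x * bCoef p t y * (bGauge p t (χ j - χ k) * bGauge p t (χ k - χ j)) *
        aCoef p t (χ i - χ k) (x + y) * (σ k * σ k * hσ j + hσ k)
  · linear_combination (-(σ i * σ j * bGauge p t (χ i - χ j))) * h₃
  · linear_combination (σ j * σ k * bGauge p t (χ j - χ k)) * h₂
  · ring
  · ring
  · ring

end YangBaxter

/-- **The shifted braid-type Yang–Baxter equation with shift vectors `Ψ`**: for all admissible
`x, y ∈ ℂ` and `φ ∈ ℂ³`,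
`R₁₂(x; φ+Ψ̂(−κ)₃) R₂₃(x+y; φ+Ψ̂(κ)₁) R₁₂(y; φ+Ψ̂(−κ)₃)
  = R₂₃(y; φ+Ψ̂(κ)₁) R₁₂(x+y; φ+Ψ̂(−κ)₃) R₂₃(x; φ+Ψ̂(κ)₁)`
as linear operators on `V ⊗ V ⊗ V`. -/
theorem shifted_qYB_Psi (p : ℝ) (hp0 : 0 < p) (hp1 : p < 1) (κ : ℂ)
    (x y : ℂ) (φ : Fin 3 → ℂ)
    (hadm : ∀ k : Fin 3, ∀ z ∈ ({x, y, x + y} : Set ℂ),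
      RAdm p κ z (fun j => φ j + Psi p (-κ) k j) ∧
        RAdm p κ z (fun j => φ j + Psi p κ k j)) :
    R12 p κ x (fun k j => φ j + Psi p (-κ) k j) *
        R23 p κ (x + y) (fun k j => φ j + Psi p κ k j) *
        R12 p κ y (fun k j => φ j + Psi p (-κ) k j) =
      R23 p κ y (fun k j => φ j + Psi p κ k j) *
        R12 p κ (x + y) (fun k j => φ j + Psi p (-κ) k j) *
        R23 p κ x (fun k j => φ j + Psi p κ k j) := by
  have hz : ∀ z ∈ ({x, y, x + y} : Set ℂ), oddTheta p z ≠ 0 ∧ oddTheta p (2 * κ + z) ≠ 0 ∧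
      oddTheta p (2 * κ - z) ≠ 0 := fun z hz =>
    have h := (hadm 0 z hz).1
    ⟨oddTheta_ne_zero h.1, oddTheta_ne_zero h.2.1, oddTheta_ne_zero h.2.2.1⟩
  have hneg : ∀ k i j, i ≠ j →
      oddTheta p ((φ i + Psi p (-κ) k i) - (φ j + Psi p (-κ) k j)) ≠ 0 := fun k i j h =>
    oddTheta_ne_zero ((hadm k x (by simp)).1.2.2.2 i j h)
  have hpos : ∀ k i j, i ≠ j →
      oddTheta p ((φ i + Psi p κ k i) - (φ j + Psi p κ k j)) ≠ 0 := fun k i j h =>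
    oddTheta_ne_zero ((hadm k x (by simp)).2.2.2.2 i j h)
  set ψ : Fin 3 → Fin 3 → ℂ := fun k j => φ j + Psi p (-κ) k j
  set ψ' : Fin 3 → Fin 3 → ℂ := fun k j => φ j + Psi p κ k j
  set S : ℂ → Matrix (Fin 3 × Fin 3 × Fin 3) (Fin 3 × Fin 3 × Fin 3) ℂ := fun z => R12 p κ z ψ
  set T : ℂ → Matrix (Fin 3 × Fin 3 × Fin 3) (Fin 3 × Fin 3 × Fin 3) ℂ := fun z => R23 p κ z ψ'
  have two (i j : Fin 3) (hij : i ≠ j) :=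
    have hshift : (φ i + Psi p (-κ) i i) - (φ j + Psi p (-κ) i j) =
        (φ i + Psi p κ i i) - (φ j + Psi p κ i j) + 2 * κ * sgn3 i := by
      linear_combination Psi_neg_sub p κ hij
    have hshift' : (φ j + Psi p (-κ) i j) - (φ i + Psi p (-κ) i i) =
        -((φ i + Psi p κ i i) - (φ j + Psi p κ i j) + 2 * κ * sgn3 i) := by
      linear_combination -Psi_neg_sub p κ hij
    have hA (z) (h : z ∈ ({x, y, x + y} : Set ℂ)) (w) :=
      Afun_eq_diagCoef_mul hp0 hp1 (hz z h).1 (hz z h).2.1 (hz z h).2.2 i w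
    have hB (z) (h : z ∈ ({x, y, x + y} : Set ℂ)) (w) : sgn3 i * sgn3 j * Bfun p κ w z =
        diagCoef p κ z i * bCoef p (2 * κ * sgn3 i) z * (sgn3 j * bGauge p (2 * κ) w) := by
      rw [Bfun_eq_diagCoef_mul hp0 hp1 (hz z h).1 (hz z h).2.1 (hz z h).2.2 i w]
      linear_combination (sgn3 j * diagCoef p κ z i * bCoef p (2 * κ * sgn3 i) z *
        bGauge p (2 * κ) w) * sgn3_mul_self i
    yangBaxter_of_two_labels hp0 hp1 (t := 2 * κ * sgn3 i)
      (v := (φ i + Psi p κ i i) - (φ j + Psi p κ i j)) (x := x) (y := y) S T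
      (Pi.single (i, i, j) 1) (Pi.single (i, j, i) 1) (Pi.single (j, i, i) 1)
      (fun z => diagCoef p κ z i) (fun w => sgn3 j * bGauge p (2 * κ) w)
      (fun z h => oddTheta_sgn_sub_ne_zero hp0 hp1 (hz z h).2.1 (hz z h).2.2 i)
      (hpos i i j hij) (hshift ▸ hneg i i j hij)
      (fun w => by
        rw [bGauge_sgn hp0 hp1]
        linear_combination (bGauge p (2 * κ) w * bGauge p (2 * κ) (-w)) * sgn3_mul_self j)
      (fun z _ => R12_mulVec_self p κ z ψ i j)
      (fun z h => by
        rw [R12_mulVec_of_ne p κ z ψ hij i, hshift, hA z h, hB z h])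
      (fun z h => by
        rw [R12_mulVec_of_ne p κ z ψ hij.symm i, hshift', hA z h,
          mul_comm (sgn3 j), hB z h])
      (fun z h => by
        rw [R23_mulVec_of_ne p κ z ψ' hij i, hA z h, hB z h])
      (fun z h => by
        rw [R23_mulVec_of_ne p κ z ψ' hij.symm i, hA z h, mul_comm (sgn3 j),
          hB z h, ← neg_sub (ψ' i i)])
      (fun z _ => R23_mulVec_self p κ z ψ' i j)
  have hχ (α) {k i j : Fin 3} (hi : k ≠ i) (hj : k ≠ j) :
      (φ i + Psi p α k i) - (φ j + Psi p α k j) =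
        (φ i + Psi p 0 0 i) - (φ j + Psi p 0 0 j) := by
    linear_combination Psi_sub_of_ne p α hi hj
  have three (i j k : Fin 3) (hij : i ≠ j) (hjk : j ≠ k) (hik : i ≠ k) :=
    yangBaxter_of_three_labels hp0 hp1 (t := 2 * κ) (x := x) (y := y) S T
      (fun i => φ i + Psi p 0 0 i) sgn3 sgn3_mul_self (fun z h => (hz z h).2.2)
      (fun i j hij => by
        obtain ⟨k, hi, hj⟩ : ∃ k : Fin 3, k ≠ i ∧ k ≠ j := by decide +revert
        exact hχ κ hi hj ▸ hpos k i j hij)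
      (fun z _ i j k hij hi hj => by
        rw [R12_mulVec_of_ne p κ z ψ hij k, hχ _ hi hj, Afun_eq, Bfun_eq hp0 hp1])
      (fun z _ i j k hij hi hj => by
        rw [R23_mulVec_of_ne p κ z ψ' hij k, hχ _ hi hj, Afun_eq, Bfun_eq hp0 hp1])
      hij hjk hik
  refine Matrix.ext_of_mulVec_single ?_
  rintro ⟨i, j, k⟩
  obtain rfl | hij := eq_or_ne i j
  · obtain rfl | hik := eq_or_ne i k
    · simp only [← Matrix.mulVec_mulVec, R12_mulVec_self, R23_mulVec_self, Matrix.mulVec_smul,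
        smul_smul]
      congr 1
      ring
    · exact (two i k hik).1
  · obtain rfl | hik := eq_or_ne i k
    · exact (two i j hij).2.1
    · obtain rfl | hjk := eq_or_ne j k
      · exact (two j i hij.symm).2.2
      · exact three i j k hij hjk hik

end
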